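/- Let Q be a stationary ergodic probability measure on 𝕏^ℤ where the alphabet 𝕏 is finite. Then the random Hilberg exponents γ⁺_Q and γ⁻_Q (computed with P = Q) are Q-almost surely constant, and Q-almost surely δ⁺_Q ≥ γ⁺_Q and δ⁻_Q ≥ γ⁻_Q. -/

import Mathlib

open MeasureTheory ProbabilityTheory Filter

noncomputable section

/-- The binary positive logarithm `log⁺ x`: `log(x+1)` for `x ≥ 0` and `0` for `x < 0`. -/
def logPlus (x : ℝ) : ℝ := if 0 ≤ x then Real.logb 2 (x + 1) else 0

variable {𝕏 : Type*}

/-- The left shift on two-sided sequences. -/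
def shift (ω : ℤ → 𝕏) : ℤ → 𝕏 := fun i => ω (i + 1)

/-- The block `X_{-n+1}^0` of a two-sided sequence. -/
def blockNeg (n : ℕ) (ω : ℤ → 𝕏) : Fin n → 𝕏 := fun i => ω (-(n : ℤ) + 1 + (i : ℕ))

/-- The block `X_1^n` of a two-sided sequence. -/
def blockPos (n : ℕ) (ω : ℤ → 𝕏) : Fin n → 𝕏 := fun i => ω (1 + (i : ℕ))

/-- The block `X_{-n+1}^n` of a two-sided sequence. -/
def blockBoth (n : ℕ) (ω : ℤ → 𝕏) : Fin (2 * n) → 𝕏 := fun i => ω (-(n : ℤ) + 1 + (i : ℕ))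

/-- A code assigns nonnegative values to finite strings. -/
def CodeNonneg (P : (n : ℕ) → (Fin n → 𝕏) → ℝ) : Prop := ∀ n x, 0 ≤ P n x

/-- A code satisfies the Kraft inequality `∑_{x_1^n} P(x_1^n) ≤ 1`. -/
def CodeKraft (P : (n : ℕ) → (Fin n → 𝕏) → ℝ) : Prop :=
  ∀ n, 1 ≤ n → ∑' x : Fin n → 𝕏, P n x ≤ 1

/-- The pointwise mutual information
`I^P(n) = -log P(X_{-n+1}^0) - log P(X_1^n) + log P(X_{-n+1}^n)` (binary logarithm). -/
def pmi (P : (n : ℕ) → (Fin n → 𝕏) → ℝ) (n : ℕ) (ω : ℤ → 𝕏) : ℝ :=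
  -Real.logb 2 (P n (blockNeg n ω)) - Real.logb 2 (P n (blockPos n ω))
    + Real.logb 2 (P (2 * n) (blockBoth n ω))

/-- The upper random Hilberg exponent `γ⁺_P = limsup_n log⁺ I^P(n) / log n`. -/
def gammaPlus (P : (n : ℕ) → (Fin n → 𝕏) → ℝ) (ω : ℤ → 𝕏) : ℝ :=
  limsup (fun n : ℕ => logPlus (pmi P n ω) / Real.logb 2 n) atTop

/-- The lower random Hilberg exponent `γ⁻_P = liminf_n log⁺ I^P(n) / log n`. -/
def gammaMinus (P : (n : ℕ) → (Fin n → 𝕏) → ℝ) (ω : ℤ → 𝕏) : ℝ :=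
  liminf (fun n : ℕ => logPlus (pmi P n ω) / Real.logb 2 n) atTop

variable [MeasurableSpace 𝕏]

/-- The upper expected Hilberg exponent `δ⁺_P = limsup_n log⁺ E_Q I^P(n) / log n`. -/
def deltaPlus (Q : Measure (ℤ → 𝕏)) (P : (n : ℕ) → (Fin n → 𝕏) → ℝ) : ℝ :=
  limsup (fun n : ℕ => logPlus (∫ ω, pmi P n ω ∂Q) / Real.logb 2 n) atTop

/-- The lower expected Hilberg exponent `δ⁻_P = liminf_n log⁺ E_Q I^P(n) / log n`. -/
def deltaMinus (Q : Measure (ℤ → 𝕏)) (P : (n : ℕ) → (Fin n → 𝕏) → ℝ) : ℝ :=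
  liminf (fun n : ℕ => logPlus (∫ ω, pmi P n ω ∂Q) / Real.logb 2 n) atTop

/-- The measure `Q` regarded as a code: `Q(x_1^n) = Q(X_1^n = x_1^n)`. -/
def measureCode (Q : Measure (ℤ → 𝕏)) : (n : ℕ) → (Fin n → 𝕏) → ℝ :=
  fun n x => (Q {ω | blockPos n ω = x}).toReal

/-- The upper inverse expected Hilberg exponent
`ζ⁺_P = limsup_n log⁺ [E_Q (I^P(n)+B)⁻¹]⁻¹ / log n`, for a constant `B`. -/
def zetaPlus (Q : Measure (ℤ → 𝕏)) (P : (n : ℕ) → (Fin n → 𝕏) → ℝ) (B : ℝ) : ℝ :=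
  limsup (fun n : ℕ => logPlus ((∫ ω, (pmi P n ω + B)⁻¹ ∂Q)⁻¹) / Real.logb 2 n) atTop

/-- The lower inverse expected Hilberg exponent
`ζ⁻_P = liminf_n log⁺ [E_Q (I^P(n)+B)⁻¹]⁻¹ / log n`, for a constant `B`. -/
def zetaMinus (Q : Measure (ℤ → 𝕏)) (P : (n : ℕ) → (Fin n → 𝕏) → ℝ) (B : ℝ) : ℝ :=
  liminf (fun n : ℕ => logPlus ((∫ ω, (pmi P n ω + B)⁻¹ ∂Q)⁻¹) / Real.logb 2 n) atTop

/-- The parameter `ε_P = limsup_n log⁺ [Var_Q I^P(n) / E_Q I^P(n)] / log n`. -/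
def epsilonExp (Q : Measure (ℤ → 𝕏)) (P : (n : ℕ) → (Fin n → 𝕏) → ℝ) : ℝ :=
  limsup (fun n : ℕ =>
    logPlus (variance (pmi P n) Q / ∫ ω, pmi P n ω ∂Q) / Real.logb 2 n) atTop

/-- `I^P` is nearly nondecreasing: for some `C ≥ 0`,
`I^P(n+m) ≥ I^P(n) - 4 log m - C` pointwise for all `n, m ≥ 1`. -/
def NearlyNondecreasing (P : (n : ℕ) → (Fin n → 𝕏) → ℝ) : Prop :=
  ∃ C : ℝ, 0 ≤ C ∧ ∀ n m : ℕ, 1 ≤ n → 1 ≤ m → ∀ ω : ℤ → 𝕏,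
    pmi P n ω - 4 * Real.logb 2 m - C ≤ pmi P (n + m) ω


section LogPlus

lemma logPlus_eq (x : ℝ) : logPlus x = Real.logb 2 (max x 0 + 1) := by
  unfold logPlus
  split_ifs with h
  · rw [max_eq_left h]
  · rw [max_eq_right (by linarith)]
    simp

lemma logPlus_nonneg (x : ℝ) : 0 ≤ logPlus x := by
  rw [logPlus_eq]
  exact Real.logb_nonneg one_lt_two (by linarith [le_max_right x 0])

lemma two_rpow_logPlus (x : ℝ) : (2 : ℝ) ^ logPlus x = max x 0 + 1 := by
  rw [logPlus_eq]
  exact Real.rpow_logb (by norm_num) (by norm_num) (by linarith [le_max_right x 0])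

lemma logPlus_mono : Monotone logPlus := by
  intro x y h
  rw [logPlus_eq, logPlus_eq]
  exact Real.logb_le_logb_of_le one_lt_two (by linarith [le_max_right x 0])
    (by linarith [max_le_max_right 0 h])

lemma logPlus_add_le (x : ℝ) {y : ℝ} (hy : 0 ≤ y) : logPlus (x + y) ≤ logPlus x + logPlus y := by
  simp only [logPlus_eq]
  have hx : 0 ≤ max x 0 := le_max_right x 0
  have hxy : max (x + y) 0 ≤ max x 0 + y :=
    max_le (by linarith [le_max_left x 0]) (by linarith)
  rw [max_eq_left hy, ← Real.logb_mul (by linarith) (by linarith)]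
  exact Real.logb_le_logb_of_le one_lt_two (by linarith [le_max_right (x + y) 0])
    (by nlinarith)

lemma logb_two_le_self {x : ℝ} (hx : 0 < x) : Real.logb 2 x ≤ x := by
  rw [Real.logb_le_iff_le_rpow one_lt_two hx]
  have h := one_add_mul_self_le_rpow_one_add (s := 1) (by norm_num) (p := max x 1)
    (le_max_right _ _)
  rcases le_total 1 x with h1 | h1
  · rw [max_eq_left h1] at h
    norm_num at h
    linarith
  · exact h1.trans (Real.one_le_rpow one_le_two hx.le)

lemma tendsto_logb_natCast : Tendsto (fun n : ℕ => Real.logb 2 n) atTop atTop :=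
  (Real.tendsto_logb_atTop one_lt_two).comp tendsto_natCast_atTop_atTop

lemma tendsto_logPlus_div_atTop : Tendsto (fun x : ℝ => logPlus x / x) atTop (nhds 0) := by
  have h1 : Tendsto (fun x : ℝ => Real.log x / x) atTop (nhds 0) :=
    Real.isLittleO_log_id_atTop.tendsto_div_nhds_zero
  have h2 : Tendsto (fun x : ℝ => (1 + Real.log x / Real.log 2) / x) atTop (nhds 0) := by
    have := (tendsto_inv_atTop_zero (𝕜 := ℝ)).add (h1.div_const (Real.log 2))
    simp only [zero_div, add_zero] at this
    refine this.congr fun x => ?_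
    ring
  refine squeeze_zero' ?_ ?_ h2
  · filter_upwards [eventually_ge_atTop 0] with x hx
    exact div_nonneg (logPlus_nonneg x) hx
  · filter_upwards [eventually_ge_atTop 1] with x hx
    have h3 : 1 + Real.log x / Real.log 2 = Real.logb 2 (2 * x) := by
      rw [Real.logb_mul two_ne_zero (by linarith), Real.logb_self_eq_one one_lt_two]
      rfl
    rw [h3, logPlus_eq, max_eq_left (by linarith)]
    gcongr
    · exact one_lt_two
    · linarith

lemma tendsto_logPlus_mul_logb_div (c : ℝ) (hc : 0 < c) :
    Tendsto (fun n : ℕ => logPlus (c * Real.logb 2 n) / Real.logb 2 n) atTop (nhds 0) := by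
  have h := (tendsto_logPlus_div_atTop.comp
    (tendsto_logb_natCast.const_mul_atTop hc)).const_mul c
  simp only [mul_zero] at h
  refine h.congr fun n => ?_
  simp only [Function.comp]
  field_simp

end LogPlus

section Discrete

variable {Ω F G H K : Type*} [MeasurableSpace Ω] {μ : Measure Ω} [IsProbabilityMeasure μ]

/-- The probability of the atom of the partition generated by `Z` that contains `ω`. -/
def atomProb (μ : Measure Ω) (Z : Ω → F) (ω : Ω) : ℝ := μ.real {ω' | Z ω' = Z ω}

lemma ae_atomProb_pos [Countable F] (Z : Ω → F) : ∀ᵐ ω ∂μ, 0 < atomProb μ Z ω := by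
  have h : ∀ z : F, ∀ᵐ ω ∂μ, Z ω = z → 0 < μ.real {ω | Z ω = z} := by
    intro z
    rcases eq_or_ne (μ {ω | Z ω = z}) 0 with h0 | h0
    · filter_upwards [measure_eq_zero_iff_ae_notMem.1 h0] with ω hω h
      exact absurd h hω
    · exact Eventually.of_forall fun ω _ => ENNReal.toReal_pos h0 (measure_ne_top _ _)
  filter_upwards [ae_all_iff.2 h] with ω hω
  exact hω _ rfl

variable [Fintype F] [MeasurableSpace F] [MeasurableSingletonClass F]
  [Fintype G] [MeasurableSpace G] [MeasurableSingletonClass G]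
  [Fintype H] [MeasurableSpace H] [MeasurableSingletonClass H]
  [Fintype K] [MeasurableSpace K] [MeasurableSingletonClass K]

lemma integrable_of_finite_valued {Z : Ω → F} (hZ : Measurable Z) (g : F → ℝ) :
    Integrable (fun ω => g (Z ω)) μ :=
  Integrable.comp_measurable (g := g) Integrable.of_finite hZ

lemma integral_of_finite_valued {Z : Ω → F} (hZ : Measurable Z) (g : F → ℝ) :
    ∫ ω, g (Z ω) ∂μ = ∑ z, μ.real {ω | Z ω = z} * g z := by
  have := Measure.isProbabilityMeasure_map (μ := μ) hZ.aemeasurable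
  rw [← integral_map hZ.aemeasurable (f := g) (measurable_of_finite g).aestronglyMeasurable,
    integral_fintype Integrable.of_finite]
  refine Finset.sum_congr rfl fun z _ => ?_
  rw [map_measureReal_apply hZ (measurableSet_singleton z)]
  rfl

lemma integrable_div_atomProb {Z : Ω → F} (hZ : Measurable Z) (g : F → ℝ) :
    Integrable (fun ω => g (Z ω) / atomProb μ Z ω) μ :=
  integrable_of_finite_valued hZ fun z => g z / μ.real {ω | Z ω = z}

lemma integral_div_atomProb_le {Z : Ω → F} (hZ : Measurable Z) (g : F → ℝ) (hg : ∀ z, 0 ≤ g z) :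
    ∫ ω, g (Z ω) / atomProb μ Z ω ∂μ ≤ ∑ z, g z := by
  have h := integral_of_finite_valued (μ := μ) hZ fun z => g z / μ.real {ω | Z ω = z}
  refine (le_of_eq h).trans (Finset.sum_le_sum fun z _ => ?_)
  rcases eq_or_ne (μ.real {ω | Z ω = z}) 0 with h0 | h0
  · simp [h0, hg z]
  · rw [mul_div_cancel₀ _ h0]

lemma sum_measureReal_eq {Z : Ω → F} (hZ : Measurable Z) : ∑ z, μ.real {ω | Z ω = z} = 1 := by
  simpa using (integral_of_finite_valued (μ := μ) hZ fun _ => 1).symm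

lemma sum_measureReal_and_eq {γ : Type*} {Z : Ω → F} (hZ : Measurable Z) {W : Ω → γ} (w : γ) :
    ∑ z, μ.real {ω | Z ω = z ∧ W ω = w} = μ.real {ω | W ω = w} := by
  have h := sum_measureReal_preimage_singleton (μ := μ.restrict {ω | W ω = w}) Finset.univ (f := Z)
    (fun y _ => hZ (measurableSet_singleton y))
  simp only [Finset.coe_univ, Set.preimage_univ, measureReal_restrict_apply_univ] at h
  rw [← h]
  refine Finset.sum_congr rfl fun z _ => ?_
  rw [measureReal_restrict_apply (hZ (measurableSet_singleton z))]
  rfl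

lemma integral_atomProb_div_le {Y : Ω → F} (hY : Measurable Y) {W : Ω → G} (hW : Measurable W) :
    Integrable (fun ω => atomProb μ Y ω / atomProb μ (fun ω => (Y ω, W ω)) ω) μ ∧
    ∫ ω, atomProb μ Y ω / atomProb μ (fun ω => (Y ω, W ω)) ω ∂μ ≤ Fintype.card G := by
  refine ⟨integrable_div_atomProb (hY.prodMk hW) fun z => μ.real {ω | Y ω = z.1},
    (integral_div_atomProb_le (hY.prodMk hW) (fun z => μ.real {ω | Y ω = z.1})
      fun _ => measureReal_nonneg).trans (le_of_eq ?_)⟩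
  rw [Fintype.sum_prod_type_right]
  simp [sum_measureReal_eq hY]

/-- The data-processing bound `E 2 ^ (I(U; V) - I(SU; VT)) ≤ 1` for the pointwise mutual
information, written in terms of atom probabilities. -/
lemma integral_pmi_ratio_le {S : Ω → F} (hS : Measurable S) {U : Ω → G} (hU : Measurable U)
    {V : Ω → H} (hV : Measurable V) {T : Ω → K} (hT : Measurable T) :
    let f := fun ω => atomProb μ (fun ω => (U ω, V ω)) ω *
      (atomProb μ (fun ω => (S ω, U ω)) ω / atomProb μ U ω) *
      (atomProb μ (fun ω => (T ω, V ω)) ω / atomProb μ V ω) /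
      atomProb μ (fun ω => ((U ω, V ω), S ω, T ω)) ω
    Integrable f μ ∧ ∫ ω, f ω ∂μ ≤ 1 := by
  intro f
  have hZ := (hU.prodMk hV).prodMk (hS.prodMk hT)
  let g : (G × H) × F × K → ℝ := fun z => μ.real {ω | (U ω, V ω) = z.1} *
    (μ.real {ω | (S ω, U ω) = (z.2.1, z.1.1)} / μ.real {ω | U ω = z.1.1}) *
    (μ.real {ω | (T ω, V ω) = (z.2.2, z.1.2)} / μ.real {ω | V ω = z.1.2})
  refine ⟨integrable_div_atomProb hZ g, (integral_div_atomProb_le hZ g fun z => ?_).trans ?_⟩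
  · positivity
  · rw [Fintype.sum_prod_type, ← sum_measureReal_eq (μ := μ) (hU.prodMk hV)]
    refine Finset.sum_le_sum fun z _ => ?_
    have hs : ∑ s, μ.real {ω | (S ω, U ω) = (s, z.1)} / μ.real {ω | U ω = z.1} ≤ 1 := by
      simp only [Prod.mk.injEq]
      rw [← Finset.sum_div, sum_measureReal_and_eq hS]
      exact div_self_le_one _
    have ht : ∑ t, μ.real {ω | (T ω, V ω) = (t, z.2)} / μ.real {ω | V ω = z.2} ≤ 1 := by
      simp only [Prod.mk.injEq]
      rw [← Finset.sum_div, sum_measureReal_and_eq hT]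
      exact div_self_le_one _
    rw [Fintype.sum_prod_type]
    simp only [g, ← Finset.mul_sum, ← Finset.sum_mul]
    rw [mul_assoc]
    refine mul_le_of_le_one_right measureReal_nonneg (mul_le_one₀ hs ?_ ht)
    exact Finset.sum_nonneg fun t _ => by positivity

lemma ae_eventually_lt_one {f : ℕ → Ω → ℝ} {w : ℕ → ℝ} (hf : ∀ n ω, 0 ≤ f n ω)
    (hi : ∀ n, Integrable (f n) μ) (hw : ∀ n, ∫ ω, f n ω ∂μ ≤ w n) (hs : Summable w) :
    ∀ᵐ ω ∂μ, ∀ᶠ n in atTop, f n ω < 1 := by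
  have h : ∀ n, μ {ω | 1 ≤ f n ω} ≤ ENNReal.ofReal (w n) := by
    intro n
    rw [ENNReal.le_ofReal_iff_toReal_le (measure_ne_top _ _)
      ((integral_nonneg (hf n)).trans (hw n))]
    have := mul_meas_ge_le_integral_of_nonneg (Eventually.of_forall (hf n)) (hi n) 1
    rw [one_mul] at this
    exact this.trans (hw n)
  have h2 : ∑' n, μ {ω | 1 ≤ f n ω} ≠ ⊤ :=
    ne_top_of_le_ne_top hs.tsum_ofReal_ne_top (ENNReal.tsum_le_tsum h)
  filter_upwards [ae_eventually_notMem h2] with ω hω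
  filter_upwards [hω] with n hn
  simpa using hn

end Discrete

section Cylinder

variable {Q : Measure (ℤ → 𝕏)}

/-- The probability that the coordinates in `A` take the same values as those of `ω`. -/
def cylProb (Q : Measure (ℤ → 𝕏)) (A : Finset ℤ) (ω : ℤ → 𝕏) : ℝ :=
  Q.real {ω' | ∀ i ∈ A, ω' i = ω i}

lemma cylProb_eq_atomProb (A : Finset ℤ) (ω : ℤ → 𝕏) :
    cylProb Q A ω = atomProb Q A.restrict ω := by
  simp [cylProb, atomProb, funext_iff]

lemma cylProb_anti [IsProbabilityMeasure Q] {A B : Finset ℤ} (h : A ⊆ B) (ω : ℤ → 𝕏) :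
    cylProb Q B ω ≤ cylProb Q A ω :=
  measureReal_mono fun _ hω i hi => hω i (h hi)

lemma ae_cylProb_pos [Fintype 𝕏] [IsProbabilityMeasure Q] :
    ∀ᵐ ω ∂Q, ∀ A : Finset ℤ, 0 < cylProb Q A ω := by
  rw [ae_all_iff]
  intro A
  simp only [cylProb_eq_atomProb]
  exact ae_atomProb_pos _

lemma atomProb_restrict_prod (A B : Finset ℤ) (ω : ℤ → 𝕏) :
    atomProb Q (fun ω => (A.restrict ω, B.restrict ω)) ω = cylProb Q (A ∪ B) ω := by
  simp only [cylProb, atomProb, Prod.mk.injEq, funext_iff, Subtype.forall, Finset.restrict,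
    Finset.forall_mem_union]

lemma atomProb_restrict_prod_prod (A B C D : Finset ℤ) (ω : ℤ → 𝕏) :
    atomProb Q (fun ω => ((A.restrict ω, B.restrict ω), C.restrict ω, D.restrict ω)) ω =
      cylProb Q ((A ∪ B) ∪ (C ∪ D)) ω := by
  simp only [cylProb, atomProb, Prod.mk.injEq, funext_iff, Subtype.forall, Finset.restrict,
    Finset.forall_mem_union]

lemma measure_block_eq (hS : MeasurePreserving shift Q Q) [Fintype 𝕏] [MeasurableSingletonClass 𝕏]
    (n : ℕ) (x : Fin n → 𝕏) (a : ℤ) :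
    Q {ω | ∀ i : Fin n, ω (a + (i : ℕ)) = x i} = Q {ω | ∀ i : Fin n, ω (1 + (i : ℕ)) = x i} := by
  have step : ∀ b : ℤ, Q {ω | ∀ i : Fin n, ω (b + 1 + (i : ℕ)) = x i} =
      Q {ω | ∀ i : Fin n, ω (b + (i : ℕ)) = x i} := by
    intro b
    have hm : MeasurableSet {ω : ℤ → 𝕏 | ∀ i : Fin n, ω (b + (i : ℕ)) = x i} := by
      rw [Set.ofPred_forall]
      exact MeasurableSet.iInter fun i => (measurableSet_singleton (x i)).preimage
        (measurable_pi_apply (b + ((i : ℕ) : ℤ)))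
    rw [← hS.measure_preimage hm.nullMeasurableSet]
    congr 1
    ext ω
    simp only [Set.mem_ofPred_eq, Set.mem_preimage, shift]
    simp only [add_right_comm]
  induction a using Int.inductionOn' (b := 1) with
  | zero => rfl
  | succ k _ ih => rw [step, ih]
  | pred k _ ih => rw [← ih, ← step, sub_add_cancel]

variable [Fintype 𝕏] [MeasurableSingletonClass 𝕏]

lemma measureCode_eq_cylProb (hS : MeasurePreserving shift Q Q) (n : ℕ) (a b : ℤ)
    (hb : b = a + n) (ω : ℤ → 𝕏) :
    measureCode Q n (fun i => ω (a + (i : ℕ))) = cylProb Q (Finset.Ico a b) ω := by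
  have h := measure_block_eq hS n (fun i => ω (a + (i : ℕ))) a
  unfold measureCode cylProb blockPos
  simp only [funext_iff]
  rw [← h, measureReal_def]
  congr 2
  ext ω'
  simp only [Set.mem_ofPred_eq, Finset.mem_Ico]
  constructor
  · intro h i hi
    have := h ⟨(i - a).toNat, by omega⟩
    have e : a + ((i - a).toNat : ℤ) = i := by omega
    simpa only [e] using this
  · intro h i
    exact h _ (by omega)

/-- The pointwise mutual information of `Q` across the time point `c`. -/
def cylPmi (Q : Measure (ℤ → 𝕏)) (c : ℤ) (n : ℕ) (ω : ℤ → 𝕏) : ℝ :=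
  -Real.logb 2 (cylProb Q (Finset.Ico (c - n) c) ω) -
    Real.logb 2 (cylProb Q (Finset.Ico c (c + n)) ω) +
    Real.logb 2 (cylProb Q (Finset.Ico (c - n) (c + n)) ω)

lemma pmi_eq_cylPmi (hS : MeasurePreserving shift Q Q) (n : ℕ) (ω : ℤ → 𝕏) :
    pmi (measureCode Q) n ω = cylPmi Q 1 n ω := by
  have e : (1 - n : ℤ) = -n + 1 := by ring
  rw [pmi, cylPmi, e, ← measureCode_eq_cylProb hS n (-n + 1) 1 (by ring),
    ← measureCode_eq_cylProb hS n 1 (1 + n) rfl,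
    ← measureCode_eq_cylProb hS (2 * n) (-n + 1) (1 + n) (by push_cast; ring)]
  rfl

lemma pmi_shift_eq_cylPmi (hS : MeasurePreserving shift Q Q) (n : ℕ) (ω : ℤ → 𝕏) :
    pmi (measureCode Q) n (shift ω) = cylPmi Q 2 n ω := by
  have e : (2 - n : ℤ) = -n + 1 + 1 := by ring
  rw [pmi, cylPmi, e, ← measureCode_eq_cylProb hS n (-n + 1 + 1) 2 (by ring),
    ← measureCode_eq_cylProb hS n 2 (2 + n) rfl,
    ← measureCode_eq_cylProb hS (2 * n) (-n + 1 + 1) (2 + n) (by push_cast; ring)]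
  unfold blockNeg blockPos blockBoth shift
  have h : ∀ a b : ℤ, a + b + 1 = a + 1 + b := fun a b => by ring
  simp only [h]
  rfl

variable [IsProbabilityMeasure Q]

lemma integral_cylProb_div_insert (A : Finset ℤ) (j : ℤ) :
    Integrable (fun ω => cylProb Q A ω / cylProb Q (insert j A) ω) Q ∧
    ∫ ω, cylProb Q A ω / cylProb Q (insert j A) ω ∂Q ≤ Fintype.card 𝕏 := by
  have h := integral_atomProb_div_le (μ := Q) (Finset.measurable_restrict A) (measurable_pi_apply j)
  have e : ∀ ω, cylProb Q (insert j A) ω = atomProb Q (fun ω => (A.restrict ω, ω j)) ω := by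
    intro ω
    simp only [cylProb, atomProb, Prod.mk.injEq, funext_iff]
    congr 1
    ext ω'
    simp [and_comm]
  simpa only [e, cylProb_eq_atomProb A] using h

lemma integral_inv_cylProb (A : Finset ℤ) :
    Integrable (fun ω => (cylProb Q A ω)⁻¹) Q ∧
    ∫ ω, (cylProb Q A ω)⁻¹ ∂Q ≤ (Fintype.card 𝕏 : ℝ) ^ A.card := by
  have h := integrable_div_atomProb (μ := Q) (Finset.measurable_restrict A) fun _ => 1
  have h' := integral_div_atomProb_le (μ := Q) (Finset.measurable_restrict A) (fun _ => 1)
    fun _ => zero_le_one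
  simp only [one_div, ← cylProb_eq_atomProb] at h h'
  refine ⟨h, h'.trans (le_of_eq ?_)⟩
  simp

/-- Enlarging the blocks decreases the pointwise mutual information only by an amount with
controlled exponential moment. -/
lemma integral_two_rpow_cylPmi_sub (c : ℤ) {n N : ℕ} (hnN : n ≤ N) :
    Integrable (fun ω => (2 : ℝ) ^ (cylPmi Q c n ω - cylPmi Q c N ω)) Q ∧
    ∫ ω, (2 : ℝ) ^ (cylPmi Q c n ω - cylPmi Q c N ω) ∂Q ≤ 1 := by
  have h := integral_pmi_ratio_le (μ := Q)
    (Finset.measurable_restrict (Finset.Ico (c - N) (c - n)))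
    (Finset.measurable_restrict (Finset.Ico (c - n) c))
    (Finset.measurable_restrict (Finset.Ico c (c + n)))
    (Finset.measurable_restrict (Finset.Ico (c + n) (c + N)))
  have e1 : Finset.Ico (c - N) (c - n) ∪ Finset.Ico (c - n) c = Finset.Ico (c - N) c :=
    Finset.Ico_union_Ico_eq_Ico (by omega) (by omega)
  have e2 : Finset.Ico (c + n) (c + N) ∪ Finset.Ico c (c + n) = Finset.Ico c (c + N) := by
    rw [Finset.union_comm]
    exact Finset.Ico_union_Ico_eq_Ico (by omega) (by omega)
  have e3 : Finset.Ico (c - n) c ∪ Finset.Ico c (c + n) = Finset.Ico (c - n) (c + n) :=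
    Finset.Ico_union_Ico_eq_Ico (by omega) (by omega)
  have e4 : Finset.Ico (c - n) (c + n) ∪
      (Finset.Ico (c - N) (c - n) ∪ Finset.Ico (c + n) (c + N)) = Finset.Ico (c - N) (c + N) := by
    ext i
    simp only [Finset.mem_union, Finset.mem_Ico]
    omega
  simp only [atomProb_restrict_prod, atomProb_restrict_prod_prod, ← cylProb_eq_atomProb,
    e1, e2, e3, e4] at h
  have key : (fun ω => cylProb Q (Finset.Ico (c - n) (c + n)) ω *
      (cylProb Q (Finset.Ico (c - N) c) ω / cylProb Q (Finset.Ico (c - n) c) ω) *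
      (cylProb Q (Finset.Ico c (c + N)) ω / cylProb Q (Finset.Ico c (c + n)) ω) /
      cylProb Q (Finset.Ico (c - N) (c + N)) ω) =ᵐ[Q]
      fun ω => (2 : ℝ) ^ (cylPmi Q c n ω - cylPmi Q c N ω) := by
    filter_upwards [ae_cylProb_pos] with ω hω
    simp only [cylPmi, Real.rpow_sub two_pos, Real.rpow_add two_pos, Real.rpow_neg two_pos.le,
      Real.rpow_logb two_pos (by norm_num : (2 : ℝ) ≠ 1) (hω _)]
    field_simp
  exact ⟨h.1.congr key, (integral_congr_ae key).symm.le.trans h.2⟩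

end Cylinder

section LimitComparison

variable {u v : ℕ → ℝ}

lemma limsup_le_limsup_of_tendsto_sub (hu0 : ∀ n, 0 ≤ u n)
    (hv : IsBoundedUnder (· ≤ ·) atTop v) (h : Tendsto (fun n => u n - v n) atTop (nhds 0)) :
    limsup u atTop ≤ limsup v atTop := by
  refine le_of_forall_pos_le_add fun ε hε => ?_
  refine limsup_le_of_le (isBoundedUnder_of ⟨0, hu0⟩).isCoboundedUnder_le ?_
  filter_upwards [eventually_lt_of_limsup_lt (lt_add_of_pos_right (limsup v atTop) (half_pos hε)) hv,
    h.eventually_lt_const (half_pos hε)] with n h1 h2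
  linarith

lemma liminf_le_liminf_of_tendsto_sub (hu0 : ∀ n, 0 ≤ u n)
    (hv : IsBoundedUnder (· ≤ ·) atTop v) (h : Tendsto (fun n => u n - v n) atTop (nhds 0)) :
    liminf u atTop ≤ liminf v atTop := by
  refine le_of_forall_pos_le_add fun ε hε => ?_
  refine liminf_le_of_frequently_le ?_ (isBoundedUnder_of ⟨0, hu0⟩)
  refine ((frequently_lt_of_liminf_lt hv.isCoboundedUnder_ge
    (lt_add_of_pos_right (liminf v atTop) (half_pos hε))).and_eventually
    (h.eventually_lt_const (half_pos hε))).mono fun n hn => ?_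
  linarith [hn.1, hn.2]

end LimitComparison

section Exponents

lemma logPlus_sub_le (x y : ℝ) : logPlus x - logPlus y ≤ logPlus |x - y| := by
  have h := logPlus_add_le y (abs_nonneg (x - y))
  have h' : logPlus x ≤ logPlus (y + |x - y|) := logPlus_mono (by linarith [le_abs_self (x - y)])
  linarith

lemma logPlus_div_logb_nonneg (x : ℝ) (n : ℕ) : 0 ≤ logPlus x / Real.logb 2 n := by
  refine div_nonneg (logPlus_nonneg x) ?_
  rcases Nat.eq_zero_or_pos n with h | h
  · simp [h]
  · exact Real.logb_nonneg one_lt_two (by exact_mod_cast h)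

variable [Fintype 𝕏] [MeasurableSingletonClass 𝕏] {Q : Measure (ℤ → 𝕏)} [IsProbabilityMeasure Q]

lemma ae_eventually_logb_cylProb_insert (A : ℕ → Finset ℤ) (j : ℕ → ℤ) :
    ∀ᵐ ω ∂Q, ∀ᶠ n : ℕ in atTop, Real.logb 2 (cylProb Q (A n) ω) -
      Real.logb 2 (cylProb Q (insert (j n) (A n)) ω) ≤ 2 * Real.logb 2 n := by
  have h := ae_eventually_lt_one (μ := Q)
    (f := fun n ω => cylProb Q (A n) ω / cylProb Q (insert (j n) (A n)) ω / (n : ℝ) ^ 2)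
    (w := fun n => Fintype.card 𝕏 * (1 / (n : ℝ) ^ 2))
    (fun n ω => by unfold cylProb; positivity)
    (fun n => (integral_cylProb_div_insert (A n) (j n)).1.div_const _)
    (fun n => by
      rw [integral_div, mul_one_div]
      gcongr
      exact (integral_cylProb_div_insert (A n) (j n)).2)
    ((Real.summable_one_div_nat_pow.2 one_lt_two).mul_left _)
  filter_upwards [h, ae_cylProb_pos] with ω hω hpos
  filter_upwards [hω, eventually_ge_atTop 1] with n hn h1
  have hn0 : (0 : ℝ) < n := by exact_mod_cast h1
  rw [div_lt_one (by positivity)] at hn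
  rw [← Real.logb_div (hpos _).ne' (hpos _).ne']
  calc _ ≤ Real.logb 2 ((n : ℝ) ^ 2) :=
        Real.logb_le_logb_of_le one_lt_two (div_pos (hpos _) (hpos _)) hn.le
    _ = _ := by rw [Real.logb_pow]; norm_num

lemma ae_eventually_abs_logb_cylProb_translate (a b : ℕ → ℤ) (hab : ∀ᶠ n in atTop, a n < b n) :
    ∀ᵐ ω ∂Q, ∀ᶠ n : ℕ in atTop, |Real.logb 2 (cylProb Q (Finset.Ico (a n + 1) (b n + 1)) ω) -
      Real.logb 2 (cylProb Q (Finset.Ico (a n) (b n)) ω)| ≤ 2 * Real.logb 2 n := by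
  filter_upwards [ae_eventually_logb_cylProb_insert (Q := Q) (fun n => Finset.Ico (a n + 1) (b n)) a,
    ae_eventually_logb_cylProb_insert (Q := Q) (fun n => Finset.Ico (a n + 1) (b n)) b,
    ae_cylProb_pos (Q := Q)] with ω h1 h2 hpos
  filter_upwards [h1, h2, hab] with n h1 h2 hn
  have e1 : insert (a n) (Finset.Ico (a n + 1) (b n)) = Finset.Ico (a n) (b n) := by
    ext i; simp only [Finset.mem_insert, Finset.mem_Ico]; omega
  have e2 : insert (b n) (Finset.Ico (a n + 1) (b n)) = Finset.Ico (a n + 1) (b n + 1) := by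
    ext i; simp only [Finset.mem_insert, Finset.mem_Ico]; omega
  have h3 := Real.logb_le_logb_of_le one_lt_two (hpos _)
    (cylProb_anti (Q := Q) (Finset.subset_insert (a n) (Finset.Ico (a n + 1) (b n))) ω)
  have h4 := Real.logb_le_logb_of_le one_lt_two (hpos _)
    (cylProb_anti (Q := Q) (Finset.subset_insert (b n) (Finset.Ico (a n + 1) (b n))) ω)
  rw [e1] at h1 h3
  rw [e2] at h2 h4
  rw [abs_le]
  constructor <;> linarith

lemma ae_eventually_abs_pmi_shift_sub (hS : MeasurePreserving shift Q Q) :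
    ∀ᵐ ω ∂Q, ∀ᶠ n : ℕ in atTop, |pmi (measureCode Q) n (shift ω) - pmi (measureCode Q) n ω| ≤
      6 * Real.logb 2 n := by
  filter_upwards [
    ae_eventually_abs_logb_cylProb_translate (Q := Q) (fun n => 1 - n) (fun _ => 1)
      (by filter_upwards [eventually_ge_atTop 1] with n hn; omega),
    ae_eventually_abs_logb_cylProb_translate (Q := Q) (fun _ => 1) (fun n => 1 + n)
      (by filter_upwards [eventually_ge_atTop 1] with n hn; omega),
    ae_eventually_abs_logb_cylProb_translate (Q := Q) (fun n => 1 - n) (fun n => 1 + n)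
      (by filter_upwards [eventually_ge_atTop 1] with n hn; omega)] with ω h1 h2 h3
  filter_upwards [h1, h2, h3] with n h1 h2 h3
  rw [pmi_shift_eq_cylPmi hS, pmi_eq_cylPmi hS, cylPmi, cylPmi]
  have e1 : (1 - n + 1 : ℤ) = 2 - n := by ring
  have e2 : (1 + n + 1 : ℤ) = 2 + n := by ring
  rw [e1] at h1 h3
  rw [e2] at h2 h3
  norm_num at h1 h2
  rw [abs_le] at *
  constructor <;> linarith [h1.1, h1.2, h2.1, h2.2, h3.1, h3.2]

lemma ae_tendsto_logPlus_pmi_shift_sub (hS : MeasurePreserving shift Q Q) :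
    ∀ᵐ ω ∂Q, Tendsto (fun n : ℕ => logPlus (pmi (measureCode Q) n (shift ω)) / Real.logb 2 n -
      logPlus (pmi (measureCode Q) n ω) / Real.logb 2 n) atTop (nhds 0) := by
  filter_upwards [ae_eventually_abs_pmi_shift_sub hS] with ω hω
  refine squeeze_zero_norm' ?_ (tendsto_logPlus_mul_logb_div 6 (by norm_num))
  filter_upwards [hω, tendsto_logb_natCast.eventually_gt_atTop 0] with n hn h0
  rw [← sub_div, Real.norm_eq_abs, abs_div, abs_of_pos h0]
  gcongr
  rw [abs_sub_le_iff]
  exact ⟨(logPlus_sub_le _ _).trans (logPlus_mono hn),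
    (logPlus_sub_le _ _).trans (logPlus_mono (by rwa [abs_sub_comm]))⟩

lemma integrable_comp_pmi (P : (n : ℕ) → (Fin n → 𝕏) → ℝ) (n : ℕ) (g : ℝ → ℝ) :
    Integrable (fun ω => g (pmi P n ω)) Q := by
  have hZ : Measurable fun ω : ℤ → 𝕏 => (blockNeg n ω, blockPos n ω, blockBoth n ω) := by
    unfold blockNeg blockPos blockBoth
    fun_prop
  exact integrable_of_finite_valued hZ fun z => g (-Real.logb 2 (P n z.1) -
    Real.logb 2 (P n z.2.1) + Real.logb 2 (P (2 * n) z.2.2))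

lemma measurable_pmi (P : (n : ℕ) → (Fin n → 𝕏) → ℝ) (n : ℕ) : Measurable (pmi P n) := by
  have hZ : Measurable fun ω : ℤ → 𝕏 => (blockNeg n ω, blockPos n ω, blockBoth n ω) := by
    unfold blockNeg blockPos blockBoth
    fun_prop
  exact (measurable_of_finite fun z : (Fin n → 𝕏) × (Fin n → 𝕏) × (Fin (2 * n) → 𝕏) =>
    -Real.logb 2 (P n z.1) - Real.logb 2 (P n z.2.1) + Real.logb 2 (P (2 * n) z.2.2)).comp hZ

lemma integral_two_rpow_pmi_sub (hS : MeasurePreserving shift Q Q) {n N : ℕ} (h : n ≤ N) :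
    ∫ ω, (2 : ℝ) ^ (pmi (measureCode Q) n ω - pmi (measureCode Q) N ω) ∂Q ≤ 1 := by
  simpa only [pmi_eq_cylPmi hS] using (integral_two_rpow_cylPmi_sub (Q := Q) 1 h).2

lemma integral_two_rpow_neg_pmi (hS : MeasurePreserving shift Q Q) (n : ℕ) :
    ∫ ω, (2 : ℝ) ^ (-pmi (measureCode Q) n ω) ∂Q ≤ 1 := by
  have h := integral_two_rpow_pmi_sub hS (Nat.zero_le n)
  have h0 : ∀ ω, pmi (measureCode Q) 0 ω = 0 := fun ω => by
    rw [pmi_eq_cylPmi hS]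
    simp [cylPmi, cylProb]
  simpa only [h0, zero_sub] using h

lemma integral_two_rpow_logPlus_pmi (hS : MeasurePreserving shift Q Q) (n : ℕ) :
    ∫ ω, (2 : ℝ) ^ logPlus (pmi (measureCode Q) n ω) ∂Q ≤
      2 * 2 ^ logPlus (∫ ω, pmi (measureCode Q) n ω ∂Q) := by
  have hi : Integrable (fun ω => pmi (measureCode Q) n ω) Q := integrable_comp_pmi _ n id
  have hi2 : Integrable (fun ω => (2 : ℝ) ^ (-pmi (measureCode Q) n ω)) Q :=
    integrable_comp_pmi _ n fun x => (2 : ℝ) ^ (-x)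
  calc ∫ ω, (2 : ℝ) ^ logPlus (pmi (measureCode Q) n ω) ∂Q
      ≤ ∫ ω, (pmi (measureCode Q) n ω + 2 ^ (-pmi (measureCode Q) n ω) + 1) ∂Q := by
        refine integral_mono (integrable_comp_pmi _ n fun x => (2 : ℝ) ^ logPlus x)
          ((hi.add hi2).add (integrable_const 1)) fun ω => ?_
        simp only [two_rpow_logPlus]
        generalize pmi (measureCode Q) n ω = x
        have hp : (0 : ℝ) < 2 ^ (-x) := Real.rpow_pos_of_pos two_pos _
        gcongr
        refine max_le (by linarith) ?_
        rcases le_or_gt 0 x with h | h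
        · linarith
        · have h' := logb_two_le_self (neg_pos.2 h)
          rw [Real.logb_le_iff_le_rpow one_lt_two (neg_pos.2 h)] at h'
          linarith
    _ = ∫ ω, pmi (measureCode Q) n ω ∂Q + ∫ ω, 2 ^ (-pmi (measureCode Q) n ω) ∂Q + 1 := by
        have h12 : Integrable (fun ω => pmi (measureCode Q) n ω +
            2 ^ (-pmi (measureCode Q) n ω)) Q := hi.add hi2
        rw [integral_add h12 (integrable_const 1), integral_add hi hi2]
        simp
    _ ≤ _ := by
        rw [two_rpow_logPlus]
        have := integral_two_rpow_neg_pmi hS n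
        linarith [le_max_left (∫ ω, pmi (measureCode Q) n ω ∂Q) 0,
          le_max_right (∫ ω, pmi (measureCode Q) n ω ∂Q) 0]

lemma integral_pmi_le (hS : MeasurePreserving shift Q Q) (n : ℕ) :
    ∫ ω, pmi (measureCode Q) n ω ∂Q ≤ n * Real.logb 2 (Fintype.card 𝕏) + 1 := by
  have : Nonempty 𝕏 := ⟨(nonempty_of_isProbabilityMeasure Q).some 0⟩
  have hc : (0 : ℝ) < Fintype.card 𝕏 := by exact_mod_cast Fintype.card_pos
  have hinv := integral_inv_cylProb (Q := Q) (Finset.Ico 1 (1 + n))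
  simp only [Int.card_Ico, add_sub_cancel_left, Int.toNat_natCast] at hinv
  have hi := hinv.1.div_const ((Fintype.card 𝕏 : ℝ) ^ n)
  calc ∫ ω, pmi (measureCode Q) n ω ∂Q
      ≤ ∫ ω, (n * Real.logb 2 (Fintype.card 𝕏) +
        (cylProb Q (Finset.Ico 1 (1 + n)) ω)⁻¹ / (Fintype.card 𝕏 : ℝ) ^ n) ∂Q := by
        refine integral_mono_ae (integrable_comp_pmi _ n id) ((integrable_const _).add hi) ?_
        filter_upwards [ae_cylProb_pos (Q := Q)] with ω hω
        have h1 := Real.logb_le_logb_of_le one_lt_two (hω _) (cylProb_anti (Q := Q)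
          (Finset.Ico_subset_Ico_right (by omega) : Finset.Ico (1 - n : ℤ) 1 ⊆
            Finset.Ico (1 - n : ℤ) (1 + n)) ω)
        have h2 := logb_two_le_self (div_pos (inv_pos.2 (hω (Finset.Ico 1 (1 + n)))) (pow_pos hc n))
        rw [Real.logb_div (inv_pos.2 (hω _)).ne' (pow_pos hc n).ne', Real.logb_inv,
          Real.logb_pow] at h2
        rw [pmi_eq_cylPmi hS, cylPmi]
        linarith
    _ = n * Real.logb 2 (Fintype.card 𝕏) +
        (∫ ω, (cylProb Q (Finset.Ico 1 (1 + n)) ω)⁻¹ ∂Q) / (Fintype.card 𝕏 : ℝ) ^ n := by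
        rw [integral_add (integrable_const _) hi, integral_div]
        simp
    _ ≤ _ := by
        gcongr
        rw [div_le_one (by positivity)]
        exact hinv.2

lemma eventually_logPlus_integral_pmi_le (hS : MeasurePreserving shift Q Q) :
    ∃ C : ℝ, ∀ᶠ n : ℕ in atTop,
      logPlus (∫ ω, pmi (measureCode Q) n ω ∂Q) / Real.logb 2 n ≤ C := by
  have : Nonempty 𝕏 := ⟨(nonempty_of_isProbabilityMeasure Q).some 0⟩
  set L := Real.logb 2 (Fintype.card 𝕏) with hL
  have hL0 : 0 ≤ L := Real.logb_nonneg one_lt_two (by exact_mod_cast Fintype.card_pos)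
  refine ⟨1 + Real.logb 2 (L + 2), ?_⟩
  filter_upwards [tendsto_logb_natCast.eventually_ge_atTop 1, eventually_ge_atTop 1] with n hn h1
  have hn1 : (1 : ℝ) ≤ n := by exact_mod_cast h1
  have hn0 : (0 : ℝ) < n := by linarith
  have hC : 0 ≤ Real.logb 2 (L + 2) := Real.logb_nonneg one_lt_two (by linarith)
  rw [div_le_iff₀ (by linarith)]
  calc logPlus (∫ ω, pmi (measureCode Q) n ω ∂Q) ≤ logPlus (n * L + 1) :=
        logPlus_mono (integral_pmi_le hS n)
    _ ≤ Real.logb 2 (n * (L + 2)) := by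
        rw [logPlus_eq, max_eq_left (by positivity)]
        exact Real.logb_le_logb_of_le one_lt_two (by positivity) (by nlinarith)
    _ = Real.logb 2 n + Real.logb 2 (L + 2) := Real.logb_mul hn0.ne' (by linarith)
    _ ≤ _ := by nlinarith

lemma ae_eventually_logPlus_pmi_lt (hS : MeasurePreserving shift Q Q) (φ : ℕ → ℕ) (ε : ℝ)
    {w : ℕ → ℝ} (hw : ∀ k, 2 * (2 : ℝ) ^ (-(ε * Real.logb 2 (φ k))) ≤ w k) (hs : Summable w) :
    ∀ᵐ ω ∂Q, ∀ᶠ k in atTop, logPlus (pmi (measureCode Q) (φ k) ω) <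
      logPlus (∫ ω, pmi (measureCode Q) (φ k) ω ∂Q) + ε * Real.logb 2 (φ k) := by
  have h := ae_eventually_lt_one (μ := Q)
    (f := fun k ω => (2 : ℝ) ^ logPlus (pmi (measureCode Q) (φ k) ω) *
      2 ^ (-(logPlus (∫ ω, pmi (measureCode Q) (φ k) ω ∂Q) + ε * Real.logb 2 (φ k))))
    (w := w) (fun k ω => by positivity)
    (fun k => (integrable_comp_pmi _ (φ k) fun x => (2 : ℝ) ^ logPlus x).mul_const _)
    (fun k => by
      rw [integral_mul_const]
      refine le_trans ?_ (hw k)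
      refine (mul_le_mul_of_nonneg_right (integral_two_rpow_logPlus_pmi hS (φ k))
        (by positivity)).trans (le_of_eq ?_)
      rw [mul_assoc, ← Real.rpow_add two_pos]
      ring_nf) hs
  filter_upwards [h] with ω hω
  filter_upwards [hω] with k hk
  rw [← Real.rpow_add two_pos, Real.rpow_lt_one_iff_of_pos two_pos] at hk
  rcases hk with hk | hk
  · linarith [hk.2]
  · norm_num at hk

lemma ae_eventually_pmi_le_pmi (hS : MeasurePreserving shift Q Q) (N : ℕ → ℕ) (hN : ∀ n, n ≤ N n) :
    ∀ᵐ ω ∂Q, ∀ᶠ n : ℕ in atTop, pmi (measureCode Q) n ω ≤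
      pmi (measureCode Q) (N n) ω + 2 * Real.logb 2 n := by
  have h := ae_eventually_lt_one (μ := Q)
    (f := fun n ω => (2 : ℝ) ^ (pmi (measureCode Q) n ω - pmi (measureCode Q) (N n) ω) /
      (n : ℝ) ^ 2)
    (w := fun n => 1 / (n : ℝ) ^ 2) (fun n ω => by positivity)
    (fun n => by
      simp only [pmi_eq_cylPmi hS]
      exact (integral_two_rpow_cylPmi_sub (Q := Q) 1 (hN n)).1.div_const _)
    (fun n => by
      rw [integral_div]
      gcongr
      exact integral_two_rpow_pmi_sub hS (hN n))
    (Real.summable_one_div_nat_pow.2 one_lt_two)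
  filter_upwards [h] with ω hω
  filter_upwards [hω, eventually_ge_atTop 1] with n hn h1
  have hn0 : (0 : ℝ) < n := by exact_mod_cast h1
  rw [div_lt_one (by positivity), ← Real.lt_logb_iff_rpow_lt one_lt_two (by positivity),
    Real.logb_pow] at hn
  norm_num at hn
  linarith

lemma ae_eventually_exponent_le (hS : MeasurePreserving shift Q Q) {r r' : ℝ} (hr : r < r')
    (h : ∀ᶠ n : ℕ in atTop, logPlus (∫ ω, pmi (measureCode Q) n ω ∂Q) / Real.logb 2 n ≤ r) :
    ∀ᵐ ω ∂Q, ∀ᶠ n : ℕ in atTop, logPlus (pmi (measureCode Q) n ω) / Real.logb 2 n ≤ r' := by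
  have hr0 : 0 ≤ r := by
    obtain ⟨n, hn⟩ := h.exists
    exact (logPlus_div_logb_nonneg _ n).trans hn
  set ε := (r' - r) / 2 with hε
  have hε0 : 0 < ε := by simp only [hε]; linarith
  have hlog : ∀ k : ℕ, Real.logb 2 ((2 ^ k : ℕ) : ℝ) = k := fun k => by
    push_cast
    rw [Real.logb_pow, Real.logb_self_eq_one one_lt_two, mul_one]
  have hsum : Summable fun k : ℕ => 2 * ((2 : ℝ) ^ (-ε)) ^ k :=
    (summable_geometric_of_lt_one (by positivity)
      (Real.rpow_lt_one_of_one_lt_of_neg one_lt_two (by linarith))).mul_left 2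
  have hk : Tendsto (fun n => Nat.log 2 n + 1) atTop atTop := by
    refine tendsto_atTop.2 fun k => ?_
    filter_upwards [eventually_ge_atTop (2 ^ k)] with n hn
    exact (Nat.le_log_of_pow_le one_lt_two hn).trans (Nat.le_succ _)
  have hlim : Tendsto (fun n : ℕ => (r + ε) + (r + ε) / Real.logb 2 n +
      logPlus (2 * Real.logb 2 n) / Real.logb 2 n) atTop (nhds (r + ε)) := by
    have := ((tendsto_logb_natCast.const_div_atTop (r + ε)).const_add (r + ε)).add
      (tendsto_logPlus_mul_logb_div 2 two_pos)
    simpa using this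
  filter_upwards [ae_eventually_logPlus_pmi_lt hS (fun k => 2 ^ k) ε
      (w := fun k : ℕ => 2 * ((2 : ℝ) ^ (-ε)) ^ k)
      (fun k => by rw [hlog, ← Real.rpow_natCast, ← Real.rpow_mul two_pos.le, neg_mul]) hsum,
    ae_eventually_pmi_le_pmi hS (fun n => 2 ^ (Nat.log 2 n + 1))
      (fun n => (Nat.lt_pow_succ_log_self one_lt_two n).le)] with ω h1 h2
  have h3 := (tendsto_pow_atTop_atTop_of_one_lt (one_lt_two : 1 < 2)).eventually h
  filter_upwards [hk.eventually h1, h2, hk.eventually h3, tendsto_logb_natCast.eventually_gt_atTop 0,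
    hlim.eventually_le_const (by linarith : r + ε < r'), eventually_ge_atTop 1]
    with n h1 h2 h3 hL hlim hn
  refine le_trans ?_ hlim
  have hkL : ((Nat.log 2 n + 1 : ℕ) : ℝ) ≤ Real.logb 2 n + 1 := by
    push_cast
    gcongr
    rw [← hlog]
    exact Real.logb_le_logb_of_le one_lt_two (by positivity)
      (by exact_mod_cast Nat.pow_log_le_self 2 (by omega))
  have hsub := (logPlus_mono h2).trans (logPlus_add_le _ (by positivity))
  rw [hlog] at h1 h3
  rw [div_le_iff₀ (by positivity)] at h3
  have hmain : (r + ε) * ((Nat.log 2 n + 1 : ℕ) : ℝ) ≤ (r + ε) * (Real.logb 2 n + 1) := by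
    gcongr
  have e : (r + ε) + (r + ε) / Real.logb 2 n + logPlus (2 * Real.logb 2 n) / Real.logb 2 n =
      ((r + ε) * (Real.logb 2 n + 1) + logPlus (2 * Real.logb 2 n)) / Real.logb 2 n := by
    field_simp
  rw [e]
  gcongr
  linarith

lemma ae_frequently_exponent_le (hS : MeasurePreserving shift Q Q) {r r' : ℝ} (hr : r < r')
    (h : ∃ᶠ n : ℕ in atTop, logPlus (∫ ω, pmi (measureCode Q) n ω ∂Q) / Real.logb 2 n ≤ r) :
    ∀ᵐ ω ∂Q, ∃ᶠ n : ℕ in atTop, logPlus (pmi (measureCode Q) n ω) / Real.logb 2 n ≤ r' := by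
  have hlim : Tendsto (fun n : ℕ => 2 * (2 : ℝ) ^ (-((r' - r) * Real.logb 2 n))) atTop
      (nhds 0) := by
    have h1 : Tendsto (fun n : ℕ => -((r' - r) * Real.logb 2 n)) atTop atBot :=
      tendsto_neg_atTop_atBot.comp (tendsto_logb_natCast.const_mul_atTop (by linarith))
    simpa using ((tendsto_rpow_atBot_of_base_gt_one 2 one_lt_two).comp h1).const_mul 2
  obtain ⟨φ, hφ, hP⟩ := extraction_forall_of_frequently (P := fun k n =>
      logPlus (∫ ω, pmi (measureCode Q) n ω ∂Q) / Real.logb 2 n ≤ r ∧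
      2 * (2 : ℝ) ^ (-((r' - r) * Real.logb 2 n)) ≤ (1 / 2) ^ k ∧ 0 < Real.logb 2 n)
    fun k => h.and_eventually ((hlim.eventually_le_const (by positivity)).and
      (tendsto_logb_natCast.eventually_gt_atTop 0))
  filter_upwards [ae_eventually_logPlus_pmi_lt hS φ (r' - r) (fun k => (hP k).2.1)
    summable_geometric_two] with ω hω
  refine hφ.tendsto_atTop.frequently (Eventually.frequently ?_)
  filter_upwards [hω] with k hk
  obtain ⟨h1, -, h3⟩ := hP k
  rw [div_le_iff₀ h3] at h1 ⊢
  linarith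

end Exponents

/-- For a stationary ergodic probability measure `Q` on `𝕏^ℤ` with `𝕏`
finite, the random Hilberg exponents `γ⁺_Q`, `γ⁻_Q` (with `P = Q`) are `Q`-a.s. constant,
and `Q`-a.s. `δ⁺_Q ≥ γ⁺_Q` and `δ⁻_Q ≥ γ⁻_Q`. -/
theorem hilberg_random_exponents_of_measure {𝕏 : Type*} [Fintype 𝕏] [MeasurableSpace 𝕏]
    [MeasurableSingletonClass 𝕏] (Q : Measure (ℤ → 𝕏)) [IsProbabilityMeasure Q]
    (hQ : Ergodic shift Q) :
    (∃ c : ℝ, ∀ᵐ ω ∂Q, gammaPlus (measureCode Q) ω = c) ∧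
    (∃ c : ℝ, ∀ᵐ ω ∂Q, gammaMinus (measureCode Q) ω = c) ∧
    (∀ᵐ ω ∂Q, gammaPlus (measureCode Q) ω ≤ deltaPlus Q (measureCode Q)) ∧
    (∀ᵐ ω ∂Q, gammaMinus (measureCode Q) ω ≤ deltaMinus Q (measureCode Q)) := by
  have hS := hQ.toMeasurePreserving
  obtain ⟨C, hC⟩ := eventually_logPlus_integral_pmi_le hS
  have hb := isBoundedUnder_of_eventually_le hC
  have hbdd : ∀ᵐ ω ∂Q, IsBoundedUnder (· ≤ ·) atTop
      fun n : ℕ => logPlus (pmi (measureCode Q) n ω) / Real.logb 2 n := by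
    filter_upwards [ae_eventually_exponent_le hS (lt_add_one C) hC] with ω hω
    exact isBoundedUnder_of_eventually_le hω
  have hm : ∀ n : ℕ, Measurable fun ω => logPlus (pmi (measureCode Q) n ω) / Real.logb 2 n :=
    fun n => (logPlus_mono.measurable.comp (measurable_pmi _ n)).div_const _
  have hlim := ae_tendsto_logPlus_pmi_shift_sub hS
  have hlim' := hlim.mono fun ω h => h.neg
  simp only [neg_sub, neg_zero] at hlim'
  have hbdd' := hS.quasiMeasurePreserving.ae hbdd
  refine ⟨hQ.ae_eq_const_of_ae_eq_comp_ae (g := gammaPlus (measureCode Q))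
      (Measurable.limsup hm).aestronglyMeasurable ?_,
    hQ.ae_eq_const_of_ae_eq_comp_ae (g := gammaMinus (measureCode Q))
      (Measurable.liminf hm).aestronglyMeasurable ?_, ?_, ?_⟩
  · filter_upwards [hbdd, hbdd', hlim, hlim'] with ω h1 h2 h3 h4
    exact le_antisymm
      (limsup_le_limsup_of_tendsto_sub (fun n => logPlus_div_logb_nonneg _ n) h1 h3)
      (limsup_le_limsup_of_tendsto_sub (fun n => logPlus_div_logb_nonneg _ n) h2 h4)
  · filter_upwards [hbdd, hbdd', hlim, hlim'] with ω h1 h2 h3 h4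
    exact le_antisymm
      (liminf_le_liminf_of_tendsto_sub (fun n => logPlus_div_logb_nonneg _ n) h1 h3)
      (liminf_le_liminf_of_tendsto_sub (fun n => logPlus_div_logb_nonneg _ n) h2 h4)
  · obtain ⟨s, -, hs, hlims⟩ := exists_seq_strictAnti_tendsto (deltaPlus Q (measureCode Q))
    have key : ∀ k, ∀ᵐ ω ∂Q, gammaPlus (measureCode Q) ω ≤ s k := by
      intro k
      obtain ⟨r, hr, hr'⟩ := exists_between (hs k)
      filter_upwards [ae_eventually_exponent_le hS hr'
        ((eventually_lt_of_limsup_lt hr hb).mono fun _ h => h.le)] with ω hω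
      exact limsup_le_of_le (isBoundedUnder_of
        ⟨0, fun n => logPlus_div_logb_nonneg _ n⟩).isCoboundedUnder_le hω
    filter_upwards [ae_all_iff.2 key] with ω hω
    exact ge_of_tendsto' hlims hω
  · obtain ⟨s, -, hs, hlims⟩ := exists_seq_strictAnti_tendsto (deltaMinus Q (measureCode Q))
    have key : ∀ k, ∀ᵐ ω ∂Q, gammaMinus (measureCode Q) ω ≤ s k := by
      intro k
      obtain ⟨r, hr, hr'⟩ := exists_between (hs k)
      filter_upwards [ae_frequently_exponent_le hS hr'
        ((frequently_lt_of_liminf_lt hb.isCoboundedUnder_ge hr).mono fun _ h => h.le)] with ω hω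
      exact liminf_le_of_frequently_le hω
        (isBoundedUnder_of ⟨0, fun n => logPlus_div_logb_nonneg _ n⟩)
    filter_upwards [ae_all_iff.2 key] with ω hω
    exact ge_of_tendsto' hlims hω
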